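/- Let a < b be real numbers, f : [a,b] → ℝ continuous, 0 < α < 1, and c_α = sin(πα)/π. Let Ω be a nonempty open interval and ψ : Ω → (0,∞) a strictly increasing C¹ function with ψ(r) → 0 as r → inf Ω and ψ(r) → +∞ as r → sup Ω. Define φ(t,r) = c_α ψ'(r) (ψ(r))^{-α} ∫_a^t e^{-(t-τ) ψ(r)} f(τ) dτ. Then for every t ∈ [a,b], I^α_a f(t) = ∫_Ω φ(t,r) dr, i.e. (1/Γ(α)) ∫_a^t (t-τ)^{α-1} f(τ) dτ = ∫_Ω φ(t,r) dr. -/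

import Mathlib

open MeasureTheory

/-- A continuous function on a nonempty open interval that is positive, tends to `0` at the
lower end and to `+∞` at the upper end maps the interval onto `(0, ∞)`. -/
lemma image_eq_Ioi_zero_of_tendsto {Ω : Set ℝ} (hΩne : Ω.Nonempty) (hΩconn : Ω.OrdConnected)
    {ψ : ℝ → ℝ} (hψpos : ∀ r ∈ Ω, 0 < ψ r) (hψcont : ContinuousOn ψ Ω)
    (hψ0 : Filter.Tendsto (fun x : Ω => ψ x) Filter.atBot (nhds 0))
    (hψtop : Filter.Tendsto (fun x : Ω => ψ x) Filter.atTop Filter.atTop) :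
    ψ '' Ω = Set.Ioi 0 := by
  have : Nonempty Ω := hΩne.to_subtype
  refine Set.Subset.antisymm (Set.image_subset_iff.2 hψpos) fun s hs => ?_
  obtain ⟨x, hx⟩ := (hψ0.eventually (gt_mem_nhds hs)).exists
  obtain ⟨y, hy⟩ := (hψtop.eventually (Filter.eventually_ge_atTop s)).exists
  exact hΩconn.isPreconnected.intermediate_value x.2 y.2 hψcont ⟨hx.le, hy⟩

/-- The Laplace transform of `s ^ (-α)`. -/
lemma integral_rpow_neg_mul_exp_neg_mul_Ioi {α u : ℝ} (hα1 : α < 1) (hu : 0 < u) :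
    ∫ s in Set.Ioi (0 : ℝ), s ^ (-α) * Real.exp (-u * s)
      = u ^ (α - 1) * Real.Gamma (1 - α) := by
  have h := Real.integral_rpow_mul_exp_neg_mul_Ioi (sub_pos.2 hα1) hu
  rw [one_div, Real.inv_rpow hu.le, ← Real.rpow_neg hu.le] at h
  simpa [neg_mul] using h

lemma integrableOn_sub_rpow_mul {a t α : ℝ} (hat : a ≤ t) (hα0 : 0 < α) {f : ℝ → ℝ}
    (hf : ContinuousOn f (Set.Icc a t)) :
    IntegrableOn (fun τ => (t - τ) ^ (α - 1) * f τ) (Set.Ioo a t) := by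
  have h : IntervalIntegrable (fun x : ℝ => x ^ (α - 1)) volume (t - a) (t - t) :=
    intervalIntegral.intervalIntegrable_rpow' (by linarith)
  have h' : IntervalIntegrable (fun τ : ℝ => (t - τ) ^ (α - 1)) volume a t := by
    simpa using h.comp_sub_left t
  have h'' := h'.mul_continuousOn (g := f) (by rwa [Set.uIcc_of_le hat])
  exact ((intervalIntegrable_iff_integrableOn_Ioc_of_le hat).1 h'').mono_set
    Set.Ioo_subset_Ioc_self

lemma integrable_diffusive_kernel {a t α : ℝ} (hat : a ≤ t) (hα0 : 0 < α) (hα1 : α < 1)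
    {f : ℝ → ℝ} (hf : ContinuousOn f (Set.Icc a t)) :
    Integrable
      (Function.uncurry fun τ s : ℝ => s ^ (-α) * Real.exp (-(t - τ) * s) * f τ)
      ((volume.restrict (Set.Ioo a t)).prod (volume.restrict (Set.Ioi 0))) := by
  have hmeas : AEStronglyMeasurable
      (Function.uncurry fun τ s : ℝ => s ^ (-α) * Real.exp (-(t - τ) * s) * f τ)
      ((volume.restrict (Set.Ioo a t)).prod (volume.restrict (Set.Ioi 0))) := by
    rw [Measure.prod_restrict]
    refine ContinuousOn.aestronglyMeasurable ?_ (measurableSet_Ioo.prod measurableSet_Ioi)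
    refine ContinuousOn.mul (ContinuousOn.mul ?_ ?_) ?_
    · exact continuousOn_snd.rpow_const fun p hp => Or.inl (ne_of_gt hp.2)
    · exact Continuous.continuousOn (by fun_prop)
    · exact hf.comp continuousOn_fst fun p hp => Set.Ioo_subset_Icc_self hp.1
  refine (integrable_prod_iff hmeas).2 ⟨?_, ?_⟩
  · refine (ae_restrict_iff' measurableSet_Ioo).2 (.of_forall fun τ hτ => ?_)
    have h := integrableOn_rpow_mul_exp_neg_mul_rpow (p := 1) (s := -α) (by linarith) one_pos
      (sub_pos.2 hτ.2)
    simp only [Real.rpow_one] at h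
    exact h.mul_const (f τ)
  · refine ((integrableOn_sub_rpow_mul hat hα0 hf.norm).mul_const
      (Real.Gamma (1 - α))).congr ?_
    refine (ae_restrict_iff' measurableSet_Ioo).2 (.of_forall fun τ hτ => ?_)
    have h : ∀ s ∈ Set.Ioi (0 : ℝ),
        ‖s ^ (-α) * Real.exp (-(t - τ) * s) * f τ‖
          = s ^ (-α) * Real.exp (-(t - τ) * s) * ‖f τ‖ := fun s hs => by
      rw [norm_mul, Real.norm_of_nonneg
        (mul_nonneg (Real.rpow_nonneg (le_of_lt hs) _) (Real.exp_nonneg _))]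
    simp only [Function.uncurry_apply_pair]
    rw [setIntegral_congr_fun measurableSet_Ioi h, integral_mul_const,
      integral_rpow_neg_mul_exp_neg_mul_Ioi hα1 (sub_pos.2 hτ.2)]
    ring

/-- The diffusive representation for the identity transformation on `(0, ∞)`. -/
lemma riemannLiouville_eq_integral_Ioi {a t α : ℝ} (hat : a ≤ t) (hα0 : 0 < α) (hα1 : α < 1)
    {f : ℝ → ℝ} (hf : ContinuousOn f (Set.Icc a t)) :
    (1 / Real.Gamma α) * ∫ τ in a..t, (t - τ) ^ (α - 1) * f τ
      = ∫ s in Set.Ioi (0 : ℝ), (Real.sin (Real.pi * α) / Real.pi) * s ^ (-α) *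
          ∫ τ in a..t, Real.exp (-(t - τ) * s) * f τ := by
  have hswap := integral_integral_swap (integrable_diffusive_kernel hat hα0 hα1 hf)
  have hinner : ∀ τ ∈ Set.Ioo a t,
      ∫ s in Set.Ioi (0 : ℝ), s ^ (-α) * Real.exp (-(t - τ) * s) * f τ
        = Real.Gamma (1 - α) * ((t - τ) ^ (α - 1) * f τ) := fun τ hτ => by
    rw [integral_mul_const, integral_rpow_neg_mul_exp_neg_mul_Ioi hα1 (sub_pos.2 hτ.2)]
    ring
  rw [setIntegral_congr_fun measurableSet_Ioo hinner, integral_const_mul] at hswap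
  simp_rw [mul_assoc, integral_const_mul] at hswap ⊢
  simp_rw [intervalIntegral.integral_of_le hat, integral_Ioc_eq_integral_Ioo]
  rw [← hswap, ← mul_assoc]
  congr 1
  have hΓα := (Real.Gamma_pos_of_pos hα0).ne'
  have hsin : Real.sin (Real.pi * α) ≠ 0 :=
    (Real.sin_pos_of_pos_of_lt_pi (by positivity)
      (mul_lt_of_lt_one_right Real.pi_pos hα1)).ne'
  have hΓ := (eq_div_iff hsin).1 (Real.Gamma_mul_Gamma_one_sub α)
  rw [div_mul_eq_mul_div, div_eq_div_iff hΓα Real.pi_ne_zero]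
  linarith

/-- Diffusive representation of the Riemann–Liouville fractional integral for a general
admissible transformation `ψ : Ω → (0,∞)`: `Ω` is a nonempty open interval, `ψ` is
strictly increasing, `C¹` (with derivative `ψ'`), `ψ(r) → 0` as `r → inf Ω` and
`ψ(r) → +∞` as `r → sup Ω` (expressed via the `atBot`/`atTop` filters of the
subtype `Ω`). Then `I^α_a f(t) = ∫_Ω φ(t,r) dr` where
`φ(t,r) = c_α ψ'(r) ψ(r)^{-α} ∫_a^t e^{-(t-τ)ψ(r)} f(τ) dτ`, `c_α = sin(πα)/π`. -/
theorem diffusive_representation_general (a b α : ℝ) (hab : a < b) (f : ℝ → ℝ)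
    (hf : ContinuousOn f (Set.Icc a b)) (hα0 : 0 < α) (hα1 : α < 1)
    (Ω : Set ℝ) (hΩne : Ω.Nonempty) (hΩopen : IsOpen Ω) (hΩconn : Ω.OrdConnected)
    (ψ ψ' : ℝ → ℝ) (hψpos : ∀ r ∈ Ω, 0 < ψ r) (hψmono : StrictMonoOn ψ Ω)
    (hψderiv : ∀ r ∈ Ω, HasDerivAt ψ (ψ' r) r) (hψ'cont : ContinuousOn ψ' Ω)
    (hψ0 : Filter.Tendsto (fun x : Ω => ψ x) Filter.atBot (nhds 0))
    (hψtop : Filter.Tendsto (fun x : Ω => ψ x) Filter.atTop Filter.atTop)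
    (t : ℝ) (ht : t ∈ Set.Icc a b) :
    (1 / Real.Gamma α) * ∫ τ in a..t, (t - τ) ^ (α - 1) * f τ
      = ∫ r in Ω, (Real.sin (Real.pi * α) / Real.pi) * ψ' r * (ψ r) ^ (-α) *
          ∫ τ in a..t, Real.exp (-(t - τ) * ψ r) * f τ := by
  have himage := image_eq_Ioi_zero_of_tendsto hΩne hΩconn hψpos
    (fun r hr => (hψderiv r hr).continuousAt.continuousWithinAt) hψ0 hψtop
  rw [riemannLiouville_eq_integral_Ioi ht.1 hα0 hα1 (hf.mono (Set.Icc_subset_Icc_right ht.2)),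
    ← himage, integral_image_eq_integral_deriv_smul_of_monotoneOn hΩopen.measurableSet
      (fun r hr => (hψderiv r hr).hasDerivWithinAt) hψmono.monotoneOn]
  refine integral_congr_ae (.of_forall fun r => ?_)
  simp only [smul_eq_mul]
  ring
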